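/- arXiv:0807.2187 — 2 statements merged into one kernel-verified Lean document; each statement's English description precedes it below -/
import Mathlib

section
/- Let α ∈ ℂ. For every real t < 0, the function u(t) := (1−t)^{−α}·F(α+1, α−1; 1; t/(t−1)) satisfies t(1−t)·u''(t) + (1−2t)·u'(t) + α(α−1)·u(t) = u(t)/(1−t); that is, u is a formal eigenfunction of the operator T₁u = −t(1−t)u'' − (1−2t)u' + u/(1−t) with eigenvalue α(α−1). -/
/-- The Gauss hypergeometric function F(a,b;c;x), defined for real x with |x| < 1 by its
power series, with Pochhammer symbols (a)_k = a(a+1)⋯(a+k−1). -/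
noncomputable def hypF (a b c : ℂ) (x : ℝ) : ℂ :=
  ∑' k : ℕ, ((ascPochhammer ℂ k).eval a * (ascPochhammer ℂ k).eval b /
    ((ascPochhammer ℂ k).eval c * (Nat.factorial k : ℂ))) * (x : ℂ) ^ k

open Filter Topology in
/-- Coefficient sequences whose successive ratios tend to one. -/
def RatOne (c : ℕ → ℂ) : Prop :=
  ∃ q : ℕ → ℂ, Tendsto q atTop (𝓝 1) ∧ ∀ n, c (n + 1) = q n * c n

/-- Coefficients of the derived series. -/
def dcoef (c : ℕ → ℂ) (n : ℕ) : ℂ := ((n : ℂ) + 1) * c (n + 1)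

open Filter Topology in
theorem tendsto_lin_div (a : ℂ) :
    Tendsto (fun n : ℕ => ((n : ℂ) + a) / ((n : ℂ) + 1)) atTop (𝓝 1) := by
  have h : Tendsto (fun n : ℕ => 1 + (a - 1) * (((1 : ℝ) / ((n : ℝ) + 1) : ℝ) : ℂ)) atTop
      (𝓝 (1 + (a - 1) * ((0 : ℝ) : ℂ))) := by
    refine tendsto_const_nhds.add (tendsto_const_nhds.mul ?_)
    exact (Complex.continuous_ofReal.tendsto 0).comp tendsto_one_div_add_atTop_nhds_zero_nat
  have h2 : (1 + (a - 1) * ((0 : ℝ) : ℂ)) = 1 := by simp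
  rw [h2] at h
  refine h.congr fun n => ?_
  have : (n : ℂ) + 1 ≠ 0 := by exact_mod_cast Nat.succ_ne_zero n
  push_cast
  field_simp
  ring

open Filter Topology in
theorem RatOne.dcoe {c : ℕ → ℂ} (h : RatOne c) : RatOne (dcoef c) := by
  obtain ⟨q, hq, hc⟩ := h
  refine ⟨fun n => ((n : ℂ) + 2) / ((n : ℂ) + 1) * q (n + 1), ?_, fun n => ?_⟩
  · simpa using (tendsto_lin_div 2).mul (hq.comp (tendsto_add_atTop_nat 1))
  · have : (n : ℂ) + 1 ≠ 0 := by exact_mod_cast Nat.succ_ne_zero n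
    simp only [dcoef, hc (n + 1)]
    push_cast
    field_simp
    ring

open Filter Topology in
theorem RatOne.summable {c : ℕ → ℂ} (h : RatOne c) {x : ℂ} (hx : ‖x‖ < 1) :
    Summable (fun n => c n * x ^ n) := by
  obtain ⟨q, hq, hc⟩ := h
  obtain ⟨r, hr, hr1⟩ := exists_between hx
  refine summable_of_ratio_norm_eventually_le hr1 ?_
  have ht : Tendsto (fun n => ‖q n * x‖) atTop (𝓝 ‖x‖) := by
    simpa using (hq.mul_const x).norm
  filter_upwards [ht.eventually_le_const hr] with n hn
  have : c (n + 1) * x ^ (n + 1) = (q n * x) * (c n * x ^ n) := by rw [hc]; ring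
  rw [this, norm_mul]
  gcongr

theorem RatOne.hasDerivAt {c : ℕ → ℂ} (h : RatOne c) {x : ℝ} (hx : |x| < 1) :
    HasDerivAt (fun y : ℝ => ∑' n, c n * (y : ℂ) ^ n)
      (∑' n, dcoef c n * (x : ℂ) ^ n) x := by
  obtain ⟨r, hr, hr1⟩ := exists_between hx
  have hr0 : 0 ≤ r := (abs_nonneg x).trans hr.le
  have hs := (h.dcoe.summable (x := (r : ℂ)) (by simpa [abs_of_nonneg hr0] using hr1)).norm
  have hu : Summable (fun n : ℕ => ‖c n‖ * n * r ^ (n - 1)) := by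
    rw [← summable_nat_add_iff 1]
    refine hs.congr fun n => ?_
    have : ‖(n : ℂ) + 1‖ = n + 1 := by
      have := Complex.norm_natCast (n + 1)
      push_cast at this
      exact this
    simp only [dcoef, norm_mul, norm_pow, Complex.norm_real, Real.norm_eq_abs, abs_of_nonneg hr0, this, Nat.add_sub_cancel]
    push_cast
    ring
  have key := hasDerivAt_tsum_of_isPreconnected (𝕜 := ℝ)
    (g := fun n (y : ℝ) => c n * (y : ℂ) ^ n)
    (g' := fun n (y : ℝ) => c n * ((n : ℂ) * (y : ℂ) ^ (n - 1))) (t := Metric.ball (0 : ℝ) r)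
    (y₀ := 0) (y := x) hu
    Metric.isOpen_ball (convex_ball (0 : ℝ) r).isPreconnected ?_ ?_ ?_ ?_ ?_
  · convert! key using 1
    have hsum : Summable (fun n : ℕ => c n * ((n : ℂ) * (x : ℂ) ^ (n - 1))) := by
      refine Summable.of_norm_bounded hu fun n => ?_
      simp only [norm_mul, norm_pow, Complex.norm_natCast, Complex.norm_real, Real.norm_eq_abs]
      rw [mul_assoc]
      gcongr
    rw [hsum.tsum_eq_zero_add]
    simp only [Nat.cast_zero, zero_mul, mul_zero, zero_add]
    refine tsum_congr fun n => ?_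
    simp [dcoef]
    ring
  · intro n y _
    have := ((hasDerivAt_pow n (y : ℂ)).comp_ofReal).const_mul (c n)
    simpa using this
  · intro n y hy
    have hy' : |y| < r := by simpa using hy
    simp only [norm_mul, norm_pow, Complex.norm_natCast, Complex.norm_real, Real.norm_eq_abs]
    rw [mul_assoc]
    gcongr
  · simpa using lt_of_le_of_lt (abs_nonneg x) hr
  · exact h.summable (x := ((0 : ℝ) : ℂ)) (by simp)
  · simpa using hr

/-- multiplication by `x` of a power series -/
theorem hasSum_shift {e : ℕ → ℂ} {x S : ℂ} (h : HasSum (fun n => e n * x ^ n) S)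
    {f : ℕ → ℂ} (h0 : f 0 = 0) (h1 : ∀ n, f (n + 1) = e n) :
    HasSum (fun n => f n * x ^ n) (x * S) := by
  have h2 := h.mul_left x
  have h3 : HasSum (fun n => f (n + 1) * x ^ (n + 1)) (x * S) := by
    convert! h2 using 2 with n
    rw [h1]; ring
  have h4 := (hasSum_nat_add_iff (f := fun n => f n * x ^ n) 1).1 h3
  simpa [h0] using h4

/-- hypergeometric coefficients -/
noncomputable def hcoef (α : ℂ) (k : ℕ) : ℂ :=
  (ascPochhammer ℂ k).eval (α + 1) * (ascPochhammer ℂ k).eval (α - 1) /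
    ((ascPochhammer ℂ k).eval 1 * (Nat.factorial k : ℂ))

theorem hcoef_succ (α : ℂ) (n : ℕ) :
    hcoef α (n + 1) = ((n : ℂ) + (α + 1)) / ((n : ℂ) + 1) * (((n : ℂ) + (α - 1)) / ((n : ℂ) + 1))
      * hcoef α n := by
  have h1 : (n : ℂ) + 1 ≠ 0 := by exact_mod_cast Nat.succ_ne_zero n
  have h2 : (n.factorial : ℂ) ≠ 0 := by exact_mod_cast n.factorial_ne_zero
  simp only [hcoef, ascPochhammer_succ_eval, ascPochhammer_eval_one, Nat.factorial_succ]
  push_cast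
  rw [add_comm (1 : ℂ) (n : ℂ)]
  field_simp
  ring

theorem hcoef_ratOne (α : ℂ) : RatOne (hcoef α) :=
  ⟨_, by simpa using (tendsto_lin_div (α + 1)).mul (tendsto_lin_div (α - 1)), hcoef_succ α⟩

theorem hyp_ode (α x : ℂ) (hx : ‖x‖ < 1) :
    x * (1 - x) * (∑' n, dcoef (dcoef (hcoef α)) n * x ^ n)
      + (1 - (2 * α + 1) * x) * (∑' n, dcoef (hcoef α) n * x ^ n)
      - (α ^ 2 - 1) * (∑' n, hcoef α n * x ^ n) = 0 := by
  have H0 := ((hcoef_ratOne α).summable hx).hasSum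
  have H1 := ((hcoef_ratOne α).dcoe.summable hx).hasSum
  have H2 := ((hcoef_ratOne α).dcoe.dcoe.summable hx).hasSum
  have X1 := hasSum_shift H1 (f := fun n => (n : ℂ) * hcoef α n) (by simp)
    (fun n => by simp [dcoef])
  have X2 := hasSum_shift H2 (f := fun n => (n : ℂ) * dcoef (hcoef α) n) (by simp)
    (fun n => by simp [dcoef])
  have XX2 := hasSum_shift X2 (f := fun n => (n : ℂ) * ((n : ℂ) - 1) * hcoef α n) (by simp)
    (fun n => by simp [dcoef]; ring)
  have T := (((X2.sub XX2).add H1).sub (X1.mul_left (2 * α + 1))).sub (H0.mul_left (α ^ 2 - 1))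
  have Z : HasSum (fun _ : ℕ => (0 : ℂ)) 0 := hasSum_zero
  have E := T.unique (Z.congr_fun ?_)
  · linear_combination E
  · intro n
    have h1 : (n : ℂ) + 1 ≠ 0 := by exact_mod_cast Nat.succ_ne_zero n
    simp only [dcoef, hcoef_succ]
    field_simp
    ring

theorem abs_x_lt {t : ℝ} (ht : t < 0) : |t / (t - 1)| < 1 := by
  have h : 0 < 1 - t := by linarith
  rw [abs_div, abs_of_neg ht, abs_of_neg (by linarith : t - 1 < 0), div_lt_one (by linarith)]
  linarith

/-- for α ∈ ℂ and every real t < 0, the function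
u(t) := (1−t)^{−α}·F(α+1,α−1;1;t/(t−1)) satisfies
t(1−t)u'' + (1−2t)u' + α(α−1)u = u/(1−t). -/
theorem stmt_12 (α : ℂ) (u : ℝ → ℂ)
    (hu : ∀ t : ℝ, u t = ((1 - t : ℝ) : ℂ) ^ (-α) * hypF (α + 1) (α - 1) 1 (t / (t - 1))) :
    ∀ t : ℝ, t < 0 →
      (t : ℂ) * (1 - (t : ℂ)) * deriv (deriv u) t + (1 - 2 * (t : ℂ)) * deriv u t
        + α * (α - 1) * u t = u t / (1 - (t : ℂ)) := by
  set F0 : ℝ → ℂ := fun y => ∑' n, hcoef α n * (y : ℂ) ^ n with hF0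
  set F1 : ℝ → ℂ := fun y => ∑' n, dcoef (hcoef α) n * (y : ℂ) ^ n with hF1
  set F2 : ℝ → ℂ := fun y => ∑' n, dcoef (dcoef (hcoef α)) n * (y : ℂ) ^ n with hF2
  set v : ℝ → ℂ := fun t => ((1 - t : ℝ) : ℂ) ^ (-α) with hv
  have hu' : u = fun t => v t * F0 (t / (t - 1)) := by
    funext t
    rw [hu t]
    rfl
  have hne : ∀ t : ℝ, t < 0 → (1 - (t : ℂ)) ≠ 0 := by
    intro t ht h
    have : (1 - t : ℝ) = 0 := by exact_mod_cast h
    linarith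
  have dX : ∀ t : ℝ, t < 0 → HasDerivAt (fun t : ℝ => t / (t - 1)) (-1 / (1 - t) ^ 2) t := by
    intro t ht
    have h1 : t - 1 ≠ 0 := by linarith
    have h2 : 1 - t ≠ 0 := by linarith
    convert! (hasDerivAt_id t).div ((hasDerivAt_id t).sub_const 1) h1 using 1
    simp only [id]
    rw [div_eq_div_iff (by positivity) (by positivity)]
    ring
  have dS : ∀ t : ℝ, HasDerivAt (fun t : ℝ => (1 - (t : ℂ))) (-1) t := by
    intro t
    simpa using (Complex.ofRealCLM.hasDerivAt (x := t)).const_sub 1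
  have dV : ∀ t : ℝ, t < 0 → HasDerivAt v (α * v t / (1 - (t : ℂ))) t := by
    intro t ht
    have hsl : (1 - (t : ℂ)) ∈ Complex.slitPlane := by
      left; simp; linarith
    have h := (hasDerivAt_id (1 - (t : ℂ))).cpow_const (c := -α) hsl
    have h2 := h.comp (𝕜 := ℝ) (𝕜' := ℂ) t (dS t)
    have h3 : v = ((fun x => id x ^ (-α)) ∘ fun t : ℝ => (1 - (t : ℂ))) := by
      funext s; simp [hv]
    rw [h3]
    convert! h2 using 1
    simp only [Function.comp, id]
    rw [Complex.cpow_sub _ _ (hne t ht), Complex.cpow_one]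
    ring
  have dF0 : ∀ t : ℝ, t < 0 → HasDerivAt (fun t : ℝ => F0 (t / (t - 1)))
      (-F1 (t / (t - 1)) / (1 - (t : ℂ)) ^ 2) t := by
    intro t ht
    have := ((hcoef_ratOne α).hasDerivAt (abs_x_lt ht)).scomp t (dX t ht)
    convert! this using 1
    simp only [Complex.real_smul, hF1]
    push_cast
    ring
  have dF1 : ∀ t : ℝ, t < 0 → HasDerivAt (fun t : ℝ => F1 (t / (t - 1)))
      (-F2 (t / (t - 1)) / (1 - (t : ℂ)) ^ 2) t := by
    intro t ht
    have := ((hcoef_ratOne α).dcoe.hasDerivAt (abs_x_lt ht)).scomp t (dX t ht)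
    convert! this using 1
    simp only [Complex.real_smul, hF2]
    push_cast
    ring
  have dU : ∀ t : ℝ, t < 0 → deriv u t =
      α * v t / (1 - (t : ℂ)) * F0 (t / (t - 1))
        + v t * (-F1 (t / (t - 1)) / (1 - (t : ℂ)) ^ 2) := by
    intro t ht
    rw [hu']
    exact ((dV t ht).mul (dF0 t ht)).deriv
  intro t ht
  have hs := hne t ht
  have hev : deriv u =ᶠ[nhds t] fun t =>
      α * v t / (1 - (t : ℂ)) * F0 (t / (t - 1))
        + v t * (-F1 (t / (t - 1)) / (1 - (t : ℂ)) ^ 2) := by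
    filter_upwards [Iio_mem_nhds ht] with s hs using dU s hs
  have dUU := (((((dV t ht).const_mul α).div (dS t) hs).mul (dF0 t ht)).add
    ((dV t ht).mul (((dF1 t ht).neg).div ((dS t).pow 2) (pow_ne_zero 2 hs)))).deriv
  have hdd := hev.deriv_eq.trans dUU
  rw [hdd, dU t ht, hu']
  have ode := hyp_ode α ((t / (t - 1) : ℝ) : ℂ) (by
    rw [Complex.norm_real]; exact abs_x_lt ht)
  change _ * F2 (t / (t - 1)) + _ * F1 (t / (t - 1)) - _ * F0 (t / (t - 1)) = 0 at ode
  have hx : ((t / (t - 1) : ℝ) : ℂ) = -(t : ℂ) / (1 - (t : ℂ)) := by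
    push_cast
    rw [← neg_sub (1 : ℂ) (t : ℂ), div_neg, neg_div]
  rw [hx] at ode
  simp only [Pi.pow_apply, Pi.neg_apply, Pi.div_apply, Pi.mul_apply]
  generalize F0 (t / (t - 1)) = f0 at *
  generalize F1 (t / (t - 1)) = f1 at *
  generalize F2 (t / (t - 1)) = f2 at *
  generalize v t = w at *
  generalize (t : ℂ) = z at *
  field_simp at ode ⊢
  push_cast
  linear_combination (-w) * ode
end

section
/- Let κ < 0 and α ∈ ℂ. Then the function w(s) := (cosh(√(−κ)·s/2))^{−2α}·F(α+1, α−1; 1; tanh²(√(−κ)·s/2)) satisfies −w''(s) − √(−κ)·coth(√(−κ)·s)·w'(s) + (2κ/(1+cosh(√(−κ)·s)))·w(s) = κ·α(α−1)·w(s) for every s > 0. -/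
lemma aux_hasSum_congr {f g : ℕ → ℂ} {a : ℂ} (h : ∀ k, f k = g k) : HasSum f a ↔ HasSum g a := by
  rw [funext h]

open Filter Topology in
lemma aux_deriv (c : ℕ → ℂ) (hc : ∀ z : ℂ, ‖z‖ < 1 → Summable fun k => c k * z ^ k)
    (z : ℂ) (hz : ‖z‖ < 1) :
    HasDerivAt (fun z : ℂ => ∑' k, c k * z ^ k) (∑' k : ℕ, ((k + 1 : ℂ) * c (k + 1)) * z ^ k) z ∧
    Summable (fun k : ℕ => ((k + 1 : ℂ) * c (k + 1)) * z ^ k) := by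
  obtain ⟨r, hr1, hr2⟩ := exists_between hz
  have hr0 : 0 ≤ r := (norm_nonneg z).trans hr1.le
  have hu : Summable fun k => ‖c k * (r : ℂ) ^ k‖ :=
    (hc r (by simpa [abs_of_nonneg hr0] using hr2)).norm
  have hd : ∀ i : ℕ, DifferentiableOn ℂ (fun w : ℂ => c i * w ^ i) (Metric.ball 0 r) := by
    intro i; fun_prop
  have hle : ∀ (i : ℕ) (w : ℂ), w ∈ Metric.ball (0 : ℂ) r → ‖c i * w ^ i‖ ≤ ‖c i * (r : ℂ) ^ i‖ := by
    intro i w hw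
    have hw' : ‖w‖ < r := by simpa using hw
    simp only [norm_mul, norm_pow, Complex.norm_real, Real.norm_eq_abs, abs_of_nonneg hr0]
    gcongr
  have hzb : z ∈ Metric.ball (0 : ℂ) r := by simpa using hr1
  have h1 := Complex.hasSum_deriv_of_summable_norm hu hd Metric.isOpen_ball hle hzb
  have h2 := (Complex.differentiableOn_tsum_of_summable_norm hu hd Metric.isOpen_ball hle).differentiableAt
    (Metric.isOpen_ball.mem_nhds hzb)
  have h3 : HasSum (fun k : ℕ => ((k + 1 : ℂ) * c (k + 1)) * z ^ k)
      (deriv (fun z : ℂ => ∑' k, c k * z ^ k) z) := by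
    have := (hasSum_nat_add_iff' 1).mpr h1
    simp only [deriv_const_mul_field, deriv_pow_field] at this
    simp only [Finset.range_one, Finset.sum_singleton, Nat.cast_zero, zero_mul, mul_zero, sub_zero] at this
    exact (aux_hasSum_congr fun k => by rw [Nat.add_sub_cancel]; push_cast; ring).mp this
  exact ⟨h3.tsum_eq ▸ h2.hasDerivAt, h3.summable⟩

lemma aux_zderiv (c : ℕ → ℂ) (hc : ∀ z : ℂ, ‖z‖ < 1 → Summable fun k => c k * z ^ k)
    (z : ℂ) (hz : ‖z‖ < 1) :
    HasSum (fun k : ℕ => (k : ℂ) * c k * z ^ k) (z * ∑' k : ℕ, ((k + 1 : ℂ) * c (k + 1)) * z ^ k) := by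
  have h := (aux_deriv c hc z hz).2.hasSum.mul_left z
  rw [← hasSum_nat_add_iff' 1]
  simp only [Finset.range_one, Finset.sum_singleton, Nat.cast_zero, zero_mul, mul_zero, sub_zero]
  exact (aux_hasSum_congr fun k => by push_cast; ring).mp h

open Filter Topology in
lemma aux_summable (a b : ℂ) (c : ℕ → ℂ)
    (hrec : ∀ k : ℕ, (k + 1 : ℂ) * (k + 1) * c (k + 1) = (a + k) * (b + k) * c k)
    (z : ℂ) (hz : ‖z‖ < 1) : Summable fun k => c k * z ^ k := by
  obtain ⟨r, hr1, hr2⟩ := exists_between hz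
  have hN : ∀ x : ℂ, Tendsto (fun k : ℕ => (x + k) / (k + 1 : ℂ)) atTop (𝓝 1) := by
    intro x
    have h1 : Tendsto (fun k : ℕ => (1 : ℂ) / ((k : ℂ) + 1)) atTop (𝓝 0) :=
      tendsto_one_div_add_atTop_nhds_zero_nat
    have h2 := (h1.const_mul (x - 1)).const_add 1
    simp only [mul_zero, add_zero] at h2
    refine h2.congr fun k => ?_
    have : (k : ℂ) + 1 ≠ 0 := by exact_mod_cast Nat.succ_ne_zero k
    field_simp
    ring
  have ht : Tendsto (fun k : ℕ => ‖(a + k) / (k + 1 : ℂ) * ((b + k) / (k + 1 : ℂ)) * z‖) atTop (𝓝 ‖z‖) := by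
    simpa using (((hN a).mul (hN b)).mul_const z).norm
  refine summable_of_ratio_norm_eventually_le hr2 ?_
  filter_upwards [ht.eventually_lt_const hr1] with k hk
  have hk1 : (k : ℂ) + 1 ≠ 0 := by exact_mod_cast Nat.succ_ne_zero k
  have : c (k + 1) * z ^ (k + 1) =
      ((a + k) / (k + 1 : ℂ) * ((b + k) / (k + 1 : ℂ)) * z) * (c k * z ^ k) := by
    have : c (k + 1) = (a + k) * (b + k) * c k / ((k + 1 : ℂ) * (k + 1)) := by
      rw [← hrec]; field_simp
    rw [this]; field_simp; ring
  rw [this, norm_mul]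
  gcongr

lemma aux_ode (a b : ℂ) (c : ℕ → ℂ)
    (hrec : ∀ k : ℕ, (k + 1 : ℂ) * (k + 1) * c (k + 1) = (a + k) * (b + k) * c k) :
    ∃ f f1 f2 : ℂ → ℂ, f = (fun z => ∑' k, c k * z ^ k) ∧
      ∀ z : ℂ, ‖z‖ < 1 → HasDerivAt f (f1 z) z ∧ HasDerivAt f1 (f2 z) z ∧
        z * (1 - z) * f2 z + (1 - (a + b + 1) * z) * f1 z - a * b * f z = 0 := by
  have hc := aux_summable a b c hrec
  set d : ℕ → ℂ := fun k => (k + 1 : ℂ) * c (k + 1) with hd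
  have hds : ∀ z : ℂ, ‖z‖ < 1 → Summable fun k => d k * z ^ k := fun z hz => (aux_deriv c hc z hz).2
  refine ⟨_, fun z => ∑' k, d k * z ^ k, fun z => ∑' k : ℕ, ((k + 1 : ℂ) * d (k + 1)) * z ^ k, rfl, ?_⟩
  intro z hz
  refine ⟨(aux_deriv c hc z hz).1, (aux_deriv d hds z hz).1, ?_⟩
  have s0 := (hc z hz).hasSum
  have s1 := (hds z hz).hasSum
  have s1z := aux_zderiv c hc z hz
  have s2z := aux_zderiv d hds z hz
  have s2zz : HasSum (fun k : ℕ => (k : ℂ) * (k - 1) * c k * z ^ k)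
      (z * (z * ∑' k : ℕ, ((k + 1 : ℂ) * d (k + 1)) * z ^ k)) := by
    rw [← hasSum_nat_add_iff' 1]
    simp only [Finset.range_one, Finset.sum_singleton, Nat.cast_zero, zero_mul, mul_zero, sub_zero]
    exact (aux_hasSum_congr fun k => by simp only [hd]; push_cast; ring).mp (s2z.mul_left z)
  have key := (((s2z.sub s2zz).add s1).sub (s1z.mul_left (a + b + 1))).sub (s0.mul_left (a * b))
  have hz0 : (fun k : ℕ => (k : ℂ) * d k * z ^ k - (k : ℂ) * (k - 1) * c k * z ^ k + d k * z ^ k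
      - (a + b + 1) * ((k : ℂ) * c k * z ^ k) - a * b * (c k * z ^ k)) = fun _ => 0 := by
    funext k
    simp only [hd]
    linear_combination z ^ k * hrec k
  rw [hz0] at key
  have := key.unique hasSum_zero
  linear_combination this

theorem stmt_16 (κ : ℝ) (hκ : κ < 0) (α : ℂ) (w : ℝ → ℂ)
    (hw : ∀ s : ℝ, w s = ((Real.cosh (Real.sqrt (-κ) * s / 2) : ℝ) : ℂ) ^ (-2 * α) *
      hypF (α + 1) (α - 1) 1 (Real.tanh (Real.sqrt (-κ) * s / 2) ^ 2)) :
    ∀ s : ℝ, 0 < s →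
      -(deriv (deriv w) s)
          - (Real.sqrt (-κ) : ℂ) *
            ((Real.cosh (Real.sqrt (-κ) * s) / Real.sinh (Real.sqrt (-κ) * s) : ℝ) : ℂ) *
            deriv w s
          + ((2 * κ / (1 + Real.cosh (Real.sqrt (-κ) * s)) : ℝ) : ℂ) * w s
        = (κ : ℂ) * α * (α - 1) * w s := by
  intro s hs
  have hm0 : 0 < Real.sqrt (-κ) := Real.sqrt_pos.mpr (by linarith)
  have hmsq : Real.sqrt (-κ) ^ 2 = -κ := Real.sq_sqrt (by linarith)
  set m := Real.sqrt (-κ) with hm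
  obtain ⟨f, f1, f2, hf, hode⟩ := aux_ode (α + 1) (α - 1)
    (fun k => (ascPochhammer ℂ k).eval (α + 1) * (ascPochhammer ℂ k).eval (α - 1) /
      ((ascPochhammer ℂ k).eval 1 * (Nat.factorial k : ℂ))) (by
      intro k
      have h1 : (k : ℂ) + 1 ≠ 0 := by exact_mod_cast Nat.succ_ne_zero k
      have h2 : (Nat.factorial k : ℂ) ≠ 0 := by exact_mod_cast Nat.factorial_ne_zero k
      simp only [ascPochhammer_succ_eval, ascPochhammer_eval_one, Nat.factorial_succ]
      push_cast
      have h3 : 1 + (k : ℂ) ≠ 0 := by rwa [add_comm]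
      field_simp
      ring)
  let P : ℝ → ℂ := fun s => ((Real.cosh (m * s / 2) : ℝ) : ℂ) ^ (-2 * α)
  let T : ℝ → ℂ := fun s => ((Real.tanh (m * s / 2) : ℝ) : ℂ)
  have hw' : w = fun s => P s * f (T s ^ 2) := by
    funext s
    rw [hw s, hf]
    simp [P, T, hypF]
  have hlin : ∀ s : ℝ, HasDerivAt (fun s : ℝ => m * s / 2) (m / 2) s := by
    intro s
    simpa using ((hasDerivAt_id s).const_mul m).div_const 2
  have hTR : ∀ s : ℝ, HasDerivAt (fun s : ℝ => Real.tanh (m * s / 2))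
      (m / 2 * (1 - Real.tanh (m * s / 2) ^ 2)) s := by
    intro s
    have hc := (Real.cosh_pos (m * s / 2)).ne'
    have h := (hlin s).sinh.div (hlin s).cosh hc
    have e : (fun s : ℝ => Real.tanh (m * s / 2)) =
        fun s => Real.sinh (m * s / 2) / Real.cosh (m * s / 2) := by
      funext s; exact Real.tanh_eq_sinh_div_cosh _
    rw [e]
    refine h.congr_deriv ?_
    rw [Real.tanh_eq_sinh_div_cosh]
    field_simp
  have hT : ∀ s : ℝ, HasDerivAt T (m / 2 * (1 - T s ^ 2)) s := by
    intro s
    refine (hTR s).ofReal_comp.congr_deriv ?_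
    simp [T]
  have hP : ∀ s : ℝ, HasDerivAt P (-α * m * P s * T s) s := by
    intro s
    have hc := Real.cosh_pos (m * s / 2)
    have hcC : ((Real.cosh (m * s / 2) : ℝ) : ℂ) ≠ 0 := by exact_mod_cast hc.ne'
    have h1 := (hlin s).cosh.ofReal_comp
    have h2 := (HasDerivAt.cpow_const (c := -2 * α) (hasDerivAt_id ((Real.cosh (m * s / 2) : ℝ) : ℂ))
      (Or.inl (by simpa only [id, Complex.ofReal_re] using hc)))
    have h3 := HasDerivAt.comp s h2 h1
    refine h3.congr_deriv ?_
    simp only [P, T, id, Real.tanh_eq_sinh_div_cosh, Complex.cpow_sub _ _ hcC, Complex.cpow_one]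
    push_cast
    push_cast at hcC
    field_simp
  have hTn : ∀ s : ℝ, ‖T s ^ 2‖ < 1 := by
    intro s
    have h1 := Real.tanh_lt_one (m * s / 2)
    have h2 := Real.neg_one_lt_tanh (m * s / 2)
    simp only [T, norm_pow, Complex.norm_real, Real.norm_eq_abs, sq_abs]
    nlinarith
  have hT2 : ∀ s : ℝ, HasDerivAt (fun s => T s ^ 2) (m * T s * (1 - T s ^ 2)) s := by
    intro s
    refine ((hT s).pow 2).congr_deriv ?_
    push_cast; ring
  have hF : ∀ s : ℝ, HasDerivAt (fun s => f (T s ^ 2)) (f1 (T s ^ 2) * (m * T s * (1 - T s ^ 2))) s :=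
    fun s => HasDerivAt.comp (h₂ := f) s (hode _ (hTn s)).1 (hT2 s)
  have hF1 : ∀ s : ℝ, HasDerivAt (fun s => f1 (T s ^ 2)) (f2 (T s ^ 2) * (m * T s * (1 - T s ^ 2))) s :=
    fun s => HasDerivAt.comp (h₂ := f1) s (hode _ (hTn s)).2.1 (hT2 s)
  have hd1 : deriv w = fun s => -α * m * P s * T s * f (T s ^ 2) +
      P s * (f1 (T s ^ 2) * (m * T s * (1 - T s ^ 2))) := by
    funext s
    rw [hw']
    exact ((hP s).mul (hF s)).deriv
  have hd2 := ((((hP s).const_mul (-α * m)).mul (hT s)).mul (hF s)).add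
    ((hP s).mul ((hF1 s).mul (((hT s).const_mul (m : ℂ)).mul ((hT2 s).const_sub 1))))
  have hd2' := (HasDerivAt.congr_of_eventuallyEq (f₁ := deriv w) hd2
    (Filter.Eventually.of_forall (by
      intro s; rw [hd1]; simp only [Pi.mul_apply, Pi.add_apply]))).deriv
  simp only [Pi.mul_apply, Pi.add_apply] at hd2'
  have hT0 : T s ≠ 0 := by
    have : 0 < Real.sinh (m * s / 2) := Real.sinh_pos_iff.mpr (by positivity)
    have hc := Real.cosh_pos (m * s / 2)
    have : 0 < Real.tanh (m * s / 2) := by rw [Real.tanh_eq_sinh_div_cosh]; positivity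
    simp only [T]
    exact_mod_cast this.ne'
  have hsh : 0 < Real.sinh (m * s / 2) := Real.sinh_pos_iff.mpr (by positivity)
  have hch := Real.cosh_pos (m * s / 2)
  have hsq := Real.cosh_sq (m * s / 2)
  have hdbl : m * s = 2 * (m * s / 2) := by ring
  have hcoth : ((Real.cosh (m * s) / Real.sinh (m * s) : ℝ) : ℂ) = (1 + T s ^ 2) / (2 * T s) := by
    have : Real.cosh (m * s) / Real.sinh (m * s) =
        (1 + Real.tanh (m * s / 2) ^ 2) / (2 * Real.tanh (m * s / 2)) := by
      rw [hdbl, Real.cosh_two_mul, Real.sinh_two_mul, ← hdbl, Real.tanh_eq_sinh_div_cosh]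
      field_simp
    rw [this]; simp [T]
  have hpot : ((2 * κ / (1 + Real.cosh (m * s)) : ℝ) : ℂ) = κ * (1 - T s ^ 2) := by
    have : 2 * κ / (1 + Real.cosh (m * s)) = κ * (1 - Real.tanh (m * s / 2) ^ 2) := by
      have e : 1 + Real.cosh (m * s) = 2 * Real.cosh (m * s / 2) ^ 2 := by
        rw [hdbl, Real.cosh_two_mul, ← hdbl]; linarith
      rw [e, Real.tanh_eq_sinh_div_cosh]
      field_simp
      rw [hsq]; ring
    rw [this]; simp [T]
  have hκm : (κ : ℂ) = -(m : ℂ) ^ 2 := by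
    have : κ = -m ^ 2 := by linarith
    exact_mod_cast this
  have hE := (hode _ (hTn s)).2.2
  rw [hcoth, hpot, hd2', hd1, hw', hκm]
  simp only []
  generalize f2 (T s ^ 2) = y2 at *
  generalize f1 (T s ^ 2) = y1 at *
  generalize f (T s ^ 2) = y at *
  generalize P s = p at *
  generalize T s = t at *
  field_simp
  linear_combination (-2 * p * m ^ 2 * (1 - t ^ 2)) * hE
end
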